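/- Consider T tasks with data distributions D_1,…,D_T on Z, samples S_j ∈ Z^{m_j} drawn i.i.d. from D_j, and assume the loss satisfies ℓ(h,z) ∈ [0,K]. Fix temperatures λ_1,…,λ_T > 0 and let Q̂^{λ_1}_{1:1} be the empirical Gibbs posterior with prior P, sample S_1 and temperature λ_1, and for j = 2,…,T let Q̂^{λ_j}_{1:j} be the empirical Gibbs posterior with prior Q̂^{λ_{j−1}}_{1:j−1}, sample S_j and temperature λ_j. Then for each i ∈ {1,…,T−1}, if λ_i = λ_T, it holds (with S_j for j ≠ i fixed and in expectation over S_i ∼ D_i^{m_i}) that E_{S_i}[L(Q̂^{λ_T}_{1:T}, D_i)] ≤ λ_T K²/(8 m_i) + (1/λ_T) E_{S_i} log ( E_{h∼P}[e^{−Σ_{j=1, j≠i}^{T} λ_j L̂(h,S_j)}] / E_{h∼P}[e^{−Σ_{j=1}^{T} λ_j L̂(h,S_j)}] ). -/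

import Mathlib

open MeasureTheory Real

/-- Expected loss `L(h, D) = E_{z∼D} ℓ(h, z)`. -/
noncomputable def expLoss {H Z : Type*} [MeasurableSpace Z] (ℓ : H → Z → ℝ) (h : H)
    (D : Measure Z) : ℝ :=
  ∫ z, ℓ h z ∂D

/-- Empirical loss `L̂(h, S) = (1/m) ∑_{j=1}^m ℓ(h, z_j)`. -/
noncomputable def empLoss {H Z : Type*} (ℓ : H → Z → ℝ) {m : ℕ} (h : H) (S : Fin m → Z) : ℝ :=
  (∑ j, ℓ h (S j)) / m

/-- The measure with density with respect to `P` proportional to `e^{−g h}`. -/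
noncomputable def gibbs {H : Type*} [MeasurableSpace H] (P : Measure H) (g : H → ℝ) :
    Measure H :=
  P.withDensity fun h => ENNReal.ofReal (Real.exp (-g h) / ∫ h', Real.exp (-g h') ∂P)

/-- Iterated Gibbs updates: `iterGibbs P g n` applies the Gibbs update successively with the
loss functions `g 0, …, g (n−1)`, starting from the prior `P`. -/
noncomputable def iterGibbs {H : Type*} [MeasurableSpace H] (P : Measure H) (g : ℕ → H → ℝ) :
    ℕ → Measure H
  | 0 => P
  | n + 1 => gibbs (iterGibbs P g n) (g n)

lemma iterGibbs_eq_tilted {H : Type*} [MeasurableSpace H] (P : Measure H) [IsProbabilityMeasure P]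
    (g : ℕ → H → ℝ) (n : ℕ) (hg : ∀ j < n, Measurable (g j)) (hg0 : ∀ j < n, ∀ h, 0 ≤ g j h) :
    iterGibbs P g n = P.tilted fun h => -∑ j ∈ Finset.range n, g j h := by
  induction n with
  | zero => simp [iterGibbs]
  | succ n ih =>
    have hint : Integrable (fun h => Real.exp (-∑ j ∈ Finset.range n, g j h)) P := by
      refine Integrable.of_bound (C := 1) (Measurable.aestronglyMeasurable ?_) (.of_forall fun h => ?_)
      · exact (Finset.measurable_fun_sum _ fun j hj =>
          hg j (by grind)).neg.exp
      · rw [Real.norm_eq_abs, Real.abs_exp, Real.exp_le_one_iff, neg_nonpos]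
        exact Finset.sum_nonneg fun j hj => hg0 j (by grind) h
    have h_ih := ih (fun j hj => hg j (by omega)) (fun j hj => hg0 j (by omega))
    change (iterGibbs P g n).tilted (fun h => -g n h) = _
    rw [h_ih, tilted_tilted hint]
    congr 1
    ext h
    simp [Finset.sum_range_succ, add_comm]

/-- Hoeffding's lemma for the one-sided deviation of an empirical mean. -/
lemma integral_exp_expLoss_sub_empLoss_le {H Z : Type*} [MeasurableSpace Z]
    (ℓ : H → Z → ℝ) (h : H) (hℓ : Measurable (ℓ h)) (K : ℝ) (hb : ∀ z, ℓ h z ∈ Set.Icc 0 K)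
    (D : Measure Z) [IsProbabilityMeasure D] {m : ℕ} (hm : 0 < m) (lam : ℝ) :
    ∫ s, Real.exp (lam * (expLoss ℓ h D - empLoss ℓ h s)) ∂(Measure.pi fun _ : Fin m => D) ≤
      Real.exp (lam ^ 2 * K ^ 2 / (8 * m)) := by
  have hm' : (m : ℝ) ≠ 0 := by positivity
  have hsub := ProbabilityTheory.hasSubgaussianMGF_of_mem_Icc (μ := D) hℓ.aemeasurable
    (.of_forall hb)
  have heq : ∀ s : Fin m → Z, Real.exp (lam * (expLoss ℓ h D - empLoss ℓ h s)) =
      ∏ j, Real.exp (-lam / m * (ℓ h (s j) - ∫ z, ℓ h z ∂D)) := by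
    intro s
    rw [← Real.exp_sum, ← Finset.mul_sum, Finset.sum_sub_distrib]
    simp only [expLoss, empLoss, Finset.sum_const, Finset.card_univ, Fintype.card_fin, nsmul_eq_mul]
    congr 1
    field_simp
    ring
  simp_rw [heq]
  rw [integral_fintype_prod_eq_pow (μ := D)
    (fun z => Real.exp (-lam / m * (ℓ h z - ∫ z, ℓ h z ∂D)))]
  refine (pow_le_pow_left₀ (integral_nonneg fun _ => (Real.exp_pos _).le)
    (hsub.mgf_le (-lam / m)) _).trans_eq ?_
  rw [← Real.exp_nat_mul]
  congr 1
  simp only [Fintype.card_fin, sub_zero, NNReal.coe_pow, NNReal.coe_div, coe_nnnorm,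
    NNReal.coe_ofNat, div_pow, Real.norm_eq_abs, sq_abs]
  field_simp
  ring

lemma measurable_expLoss {H Z : Type*} [MeasurableSpace H] [MeasurableSpace Z]
    {ℓ : H → Z → ℝ} (hℓ : Measurable (Function.uncurry ℓ)) (D : Measure Z) [SFinite D] :
    Measurable fun h => expLoss ℓ h D :=
  (hℓ.stronglyMeasurable.integral_prod_right (ν := D)).measurable

lemma measurable_empLoss {H Z : Type*} [MeasurableSpace H] [MeasurableSpace Z]
    {ℓ : H → Z → ℝ} (hℓ : Measurable (Function.uncurry ℓ)) (m : ℕ) :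
    Measurable fun p : H × (Fin m → Z) => empLoss ℓ p.1 p.2 := by
  refine (Finset.measurable_fun_sum _ fun j _ => ?_).div_const _
  exact hℓ.comp (measurable_fst.prodMk ((measurable_pi_apply j).comp measurable_snd))

lemma expLoss_mem_Icc {H Z : Type*} [MeasurableSpace Z] {ℓ : H → Z → ℝ} {h : H}
    (hℓ : Measurable (ℓ h)) {K : ℝ} (hb : ∀ z, ℓ h z ∈ Set.Icc 0 K)
    (D : Measure Z) [IsProbabilityMeasure D] : expLoss ℓ h D ∈ Set.Icc 0 K := by
  refine ⟨integral_nonneg fun z => (hb z).1, ?_⟩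
  have hint : Integrable (ℓ h) D := Integrable.of_bound hℓ.aestronglyMeasurable K
    (.of_forall fun z => by rw [Real.norm_eq_abs, abs_of_nonneg (hb z).1]; exact (hb z).2)
  simpa [expLoss] using integral_mono hint (integrable_const K) fun z => (hb z).2

lemma empLoss_mem_Icc {H Z : Type*} {ℓ : H → Z → ℝ} {h : H} {K : ℝ}
    (hb : ∀ z, ℓ h z ∈ Set.Icc 0 K) {m : ℕ} (hm : 0 < m) (s : Fin m → Z) :
    empLoss ℓ h s ∈ Set.Icc 0 K := by
  refine ⟨div_nonneg (Finset.sum_nonneg fun j _ => (hb _).1) (Nat.cast_nonneg m), ?_⟩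
  rw [empLoss, div_le_iff₀ (by positivity), mul_comm]
  simpa using Finset.sum_le_sum fun j (_ : j ∈ Finset.univ) => (hb (s j)).2

/-- A Gibbs variational bound: the mean of `u` under the tilt of `Q` by `-v`. -/
lemma integral_tilted_neg_le {H : Type*} [MeasurableSpace H] (Q : Measure H)
    [IsProbabilityMeasure Q] {u v : H → ℝ} (hu : Measurable u) (hv : Measurable v) {C : ℝ}
    (hu' : ∀ h, u h ∈ Set.Icc 0 C) (hv' : ∀ h, v h ∈ Set.Icc 0 C) :
    ∫ h, u h ∂(Q.tilted fun h => -v h) ≤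
      -Real.log (∫ h, Real.exp (-v h) ∂Q) + Real.log (∫ h, Real.exp (u h - v h) ∂Q) := by
  have hint : Integrable (fun h => Real.exp (-v h)) Q :=
    Integrable.of_bound hv.neg.exp.aestronglyMeasurable 1 (.of_forall fun h => by
      simpa [Real.abs_exp] using (hv' h).1)
  have hintuv : Integrable (fun h => Real.exp (u h - v h)) Q :=
    Integrable.of_bound (hu.sub hv).exp.aestronglyMeasurable (Real.exp C) (.of_forall fun h => by
      simpa [Real.abs_exp] using by linarith [(hv' h).1, (hu' h).2])
  have := isProbabilityMeasure_tilted hint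
  have hintu : Integrable u (Q.tilted fun h => -v h) :=
    Integrable.of_bound hu.aestronglyMeasurable C (.of_forall fun h => by
      rw [Real.norm_eq_abs, abs_of_nonneg (hu' h).1]; exact (hu' h).2)
  have hintexp : Integrable (fun h => Real.exp (u h)) (Q.tilted fun h => -v h) :=
    Integrable.of_bound hu.exp.aestronglyMeasurable (Real.exp C) (.of_forall fun h => by
      simpa [Real.abs_exp] using (hu' h).2)
  have hjensen := convexOn_exp.map_integral_le Real.continuous_exp.continuousOn isClosed_univ
    (.of_forall fun h => Set.mem_univ _) hintu hintexp
  rw [integral_exp_tilted] at hjensen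
  have hsum : ((fun h => -v h) + u) = fun h => u h - v h := by ext h; simp [sub_eq_neg_add]
  rw [hsum, ← Real.le_log_iff_exp_le (div_pos (integral_exp_pos hintuv) (integral_exp_pos hint)),
    Real.log_div (integral_exp_pos hintuv).ne' (integral_exp_pos hint).ne'] at hjensen
  linarith

/-- Oracle bound for the empirical Gibbs posterior with a prior independent of the sample. -/
lemma integral_expLoss_tilted_le {H Z : Type*} [MeasurableSpace H] [MeasurableSpace Z]
    {ℓ : H → Z → ℝ} (hℓ : Measurable (Function.uncurry ℓ))
    {K : ℝ} (hb : ∀ h z, ℓ h z ∈ Set.Icc 0 K) (D : Measure Z) [IsProbabilityMeasure D]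
    (Q : Measure H) [IsProbabilityMeasure Q] {m : ℕ} (hm : 0 < m) {lam : ℝ} (hlam : 0 < lam) :
    ∫ s, (∫ h, expLoss ℓ h D ∂(Q.tilted fun h => -(lam * empLoss ℓ h s)))
        ∂(Measure.pi fun _ : Fin m => D) ≤
      lam * K ^ 2 / (8 * m) + (1 / lam) *
        ∫ s, -Real.log (∫ h, Real.exp (-(lam * empLoss ℓ h s)) ∂Q)
          ∂(Measure.pi fun _ : Fin m => D) := by
  set ν : Measure (Fin m → Z) := Measure.pi fun _ : Fin m => D
  have hL := measurable_expLoss hℓ D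
  have hE := measurable_empLoss hℓ m
  have hLb : ∀ h, expLoss ℓ h D ∈ Set.Icc 0 K := fun h =>
    expLoss_mem_Icc hℓ.of_uncurry_left (hb h) D
  have hEb : ∀ h (s : Fin m → Z), empLoss ℓ h s ∈ Set.Icc 0 K := fun h s =>
    empLoss_mem_Icc (hb h) hm s
  have hEs : ∀ s : Fin m → Z, Measurable fun h => empLoss ℓ h s := fun s =>
    hE.comp measurable_prodMk_right
  set B : (Fin m → Z) → ℝ := fun s => ∫ h, Real.exp (-(lam * empLoss ℓ h s)) ∂Q
  set X : (Fin m → Z) → ℝ := fun s =>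
    ∫ h, Real.exp (lam * expLoss ℓ h D - lam * empLoss ℓ h s) ∂Q with hX
  set c : ℝ := lam ^ 2 * K ^ 2 / (8 * m) with hc
  have hF : Measurable (Function.uncurry fun h (s : Fin m → Z) =>
      Real.exp (lam * expLoss ℓ h D - lam * empLoss ℓ h s)) :=
    (((hL.comp measurable_fst).const_mul lam).sub (hE.const_mul lam)).exp
  have hFint : Integrable (Function.uncurry fun h (s : Fin m → Z) =>
      Real.exp (lam * expLoss ℓ h D - lam * empLoss ℓ h s)) (Q.prod ν) := by
    refine Integrable.of_bound hF.aestronglyMeasurable (Real.exp (lam * K)) (.of_forall ?_)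
    rintro ⟨h, s⟩
    simp only [Function.uncurry_apply_pair, Real.norm_eq_abs, Real.abs_exp, Real.exp_le_exp]
    nlinarith [(hLb h).2, (hEb h s).1]
  have hXint : Integrable X ν := hFint.integral_prod_right
  have hXle : ∫ s, X s ∂ν ≤ Real.exp c := by
    rw [hX, ← integral_integral_swap hFint]
    have hle : ∀ h, ∫ s, Real.exp (lam * expLoss ℓ h D - lam * empLoss ℓ h s) ∂ν ≤ Real.exp c :=
      fun h => by
        simpa only [mul_sub] using integral_exp_expLoss_sub_empLoss_le ℓ h hℓ.of_uncurry_left K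
          (hb h) D hm lam
    simpa using integral_mono hFint.integral_prod_left (integrable_const _) hle
  have hXpos : ∀ s, 0 < X s := fun s => integral_exp_pos <|
    Integrable.of_bound (hF.comp measurable_prodMk_right).aestronglyMeasurable
      (Real.exp (lam * K)) (.of_forall fun h => by
        simp only [Real.norm_eq_abs, Real.abs_exp, Real.exp_le_exp]
        nlinarith [(hLb h).2, (hEb h s).1])
  have hBmeas : Measurable B := by
    have : Measurable (Function.uncurry fun h (s : Fin m → Z) =>
      Real.exp (-(lam * empLoss ℓ h s))) := (hE.const_mul lam).neg.exp
    exact (this.stronglyMeasurable.integral_prod_left (μ := Q)).measurable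
  have hBint : ∀ s, Integrable (fun h => Real.exp (-(lam * empLoss ℓ h s))) Q := fun s =>
    Integrable.of_bound ((hEs s).const_mul lam).neg.exp.aestronglyMeasurable 1
      (.of_forall fun h => by
        simpa [Real.abs_exp] using mul_nonneg hlam.le (hEb h s).1)
  have hBle : ∀ s, B s ≤ 1 := fun s => by
    simpa using integral_mono (hBint s) (integrable_const 1) fun h => by
      simpa using mul_nonneg hlam.le (hEb h s).1
  have hleB : ∀ s, Real.exp (-(lam * K)) ≤ B s := fun s => by
    simpa using integral_mono (integrable_const (Real.exp (-(lam * K)))) (hBint s) fun h => by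
      simpa using mul_le_mul_of_nonneg_left (hEb h s).2 hlam.le
  have hlogint : Integrable (fun s => -Real.log (B s)) ν := by
    refine Integrable.of_bound (Real.measurable_log.comp hBmeas).neg.aestronglyMeasurable (lam * K)
      (.of_forall fun s => ?_)
    have hpos : 0 < B s := (Real.exp_pos _).trans_le (hleB s)
    rw [norm_neg, Real.norm_eq_abs, abs_of_nonpos (Real.log_nonpos hpos.le (hBle s)), neg_le,
      Real.le_log_iff_exp_le hpos]
    exact hleB s
  have hpt : ∀ s, ∫ h, expLoss ℓ h D ∂(Q.tilted fun h => -(lam * empLoss ℓ h s)) ≤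
      (1 / lam) * (-Real.log (B s) + (c + (Real.exp (-c) * X s - 1))) := fun s => by
    have hvar := integral_tilted_neg_le Q (hL.const_mul lam) ((hEs s).const_mul lam)
      (C := lam * K)
      (fun h => ⟨mul_nonneg hlam.le (hLb h).1, mul_le_mul_of_nonneg_left (hLb h).2 hlam.le⟩)
      (fun h => ⟨mul_nonneg hlam.le (hEb h s).1, mul_le_mul_of_nonneg_left (hEb h s).2 hlam.le⟩)
    rw [integral_const_mul] at hvar
    have hlog := Real.log_le_sub_one_of_pos (mul_pos (Real.exp_pos (-c)) (hXpos s))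
    rw [Real.log_mul (Real.exp_pos _).ne' (hXpos s).ne', Real.log_exp] at hlog
    rw [one_div, ← div_eq_inv_mul, le_div_iff₀ hlam, mul_comm]
    refine hvar.trans ?_
    gcongr
    linarith
  have hX1int : Integrable (fun s => Real.exp (-c) * X s - 1) ν :=
    (hXint.const_mul _).sub (integrable_const 1)
  have hrint : Integrable (fun s => c + (Real.exp (-c) * X s - 1)) ν :=
    (integrable_const c).add hX1int
  refine (integral_mono_of_nonneg (.of_forall fun s => integral_nonneg fun h => (hLb h).1)
    ((hlogint.add hrint).const_mul (1 / lam)) (.of_forall hpt)).trans ?_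
  have hrle : ∫ s, (c + (Real.exp (-c) * X s - 1)) ∂ν ≤ c := by
    rw [integral_add (integrable_const c) hX1int,
      integral_sub (hXint.const_mul _) (integrable_const 1), integral_const_mul]
    have := mul_le_mul_of_nonneg_left hXle (Real.exp_pos (-c)).le
    rw [← Real.exp_add, neg_add_cancel, Real.exp_zero] at this
    simpa using this
  have hsplit : ∫ s, (1 / lam) * (-Real.log (B s) + (c + (Real.exp (-c) * X s - 1))) ∂ν =
      (1 / lam) * (∫ s, -Real.log (B s) ∂ν) +
        (1 / lam) * ∫ s, (c + (Real.exp (-c) * X s - 1)) ∂ν := by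
    rw [integral_const_mul, integral_add hlogint hrint, mul_add]
  have hcle := mul_le_mul_of_nonneg_left hrle (one_div_pos.2 hlam).le
  have hceq : (1 / lam) * c = lam * K ^ 2 / (8 * m) := by
    rw [hc]
    field_simp
  refine hsplit.le.trans ?_
  linarith

/-- T-task oracle bound for iterated empirical Gibbs posteriors (tasks indexed `0,…,T−1`).
For a non-final task `i` with `λ_i = λ_{T-1}` (the paper's `λ_i = λ_T`), with the samples of the
other tasks fixed and in expectation over `S_i ∼ D_i^{m_i}`:
`E_{S_i} L(Q̂_{1:T}, D_i) ≤ λ_T K²/(8 m_i)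
  + (1/λ_T) E_{S_i} log ( E_{h∼P} e^{−∑_{j≠i} λ_j L̂(h,S_j)} / E_{h∼P} e^{−∑_j λ_j L̂(h,S_j)} )`. -/
theorem gibbs_T_task_oracle {H Z : Type*} [MeasurableSpace H] [MeasurableSpace Z]
    (ℓ : H → Z → ℝ) (hℓ : Measurable (Function.uncurry ℓ))
    (K : ℝ) (hb : ∀ h z, ℓ h z ∈ Set.Icc 0 K)
    (T : ℕ) (D : ℕ → Measure Z) (hD : ∀ j < T, IsProbabilityMeasure (D j))
    (P : Measure H) [IsProbabilityMeasure P]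
    (m : ℕ → ℕ) (hm : ∀ j < T, 0 < m j)
    (S : (j : ℕ) → Fin (m j) → Z)
    (lam : ℕ → ℝ) (hlam : ∀ j < T, 0 < lam j)
    (i : ℕ) (hi : i < T - 1) (hlami : lam i = lam (T - 1)) :
    (∫ s, (∫ h, expLoss ℓ h (D i)
          ∂(iterGibbs P (fun j h => lam j * empLoss ℓ h (Function.update S i s j)) T))
        ∂(Measure.pi fun _ : Fin (m i) => D i)) ≤
      lam (T - 1) * K ^ 2 / (8 * m i) +
        (1 / lam (T - 1)) *
          ∫ s, Real.log
            ((∫ h, Real.exp (-∑ j ∈ (Finset.range T).erase i,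
                lam j * empLoss ℓ h (Function.update S i s j)) ∂P) /
              ∫ h, Real.exp (-∑ j ∈ Finset.range T,
                lam j * empLoss ℓ h (Function.update S i s j)) ∂P)
            ∂(Measure.pi fun _ : Fin (m i) => D i) := by
  have hiT : i < T := by omega
  have := hD i hiT
  have hmeas : ∀ j (x : Fin (m j) → Z), Measurable fun h => lam j * empLoss ℓ h x := fun j x =>
    ((measurable_empLoss hℓ (m j)).comp measurable_prodMk_right).const_mul (lam j)
  have hnn : ∀ j < T, ∀ (x : Fin (m j) → Z) h, 0 ≤ lam j * empLoss ℓ h x := fun j hj x h =>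
    mul_nonneg (hlam j hj).le (empLoss_mem_Icc (hb h) (hm j hj) x).1
  set f : H → ℝ := fun h => ∑ j ∈ (Finset.range T).erase i, lam j * empLoss ℓ h (S j)
  have hfint : Integrable (fun h => Real.exp (-f h)) P := by
    refine Integrable.of_bound
      (Finset.measurable_fun_sum _ fun j _ => hmeas j (S j)).neg.exp.aestronglyMeasurable 1
      (.of_forall fun h => ?_)
    simpa [Real.abs_exp] using Finset.sum_nonneg fun j hj => hnn j (by grind) (S j) h
  have herase : ∀ s h, ∑ j ∈ (Finset.range T).erase i,
      lam j * empLoss ℓ h (Function.update S i s j) = f h := fun s h =>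
    Finset.sum_congr rfl fun j hj => by rw [Function.update_of_ne (Finset.ne_of_mem_erase hj)]
  have hall : ∀ s h, ∑ j ∈ Finset.range T, lam j * empLoss ℓ h (Function.update S i s j) =
      f h + lam (T - 1) * empLoss ℓ h s := fun s h => by
    rw [← Finset.sum_erase_add _ _ (Finset.mem_range.2 hiT), herase, Function.update_self, hlami]
  have hQ := isProbabilityMeasure_tilted hfint
  have hpost : ∀ s, iterGibbs P (fun j h => lam j * empLoss ℓ h (Function.update S i s j)) T =
      (P.tilted fun h => -f h).tilted fun h => -(lam (T - 1) * empLoss ℓ h s) := fun s => by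
    rw [iterGibbs_eq_tilted P _ T (fun j _ => hmeas j _) (fun j hj => hnn j hj _),
      tilted_tilted hfint]
    congr 1
    ext h
    simp only [hall, Pi.add_apply]
    ring
  have hratio : ∀ s : Fin (m i) → Z,
      Real.log ((∫ h, Real.exp (-f h) ∂P) /
        ∫ h, Real.exp (-(f h + lam (T - 1) * empLoss ℓ h s)) ∂P) =
      -Real.log (∫ h, Real.exp (-(lam (T - 1) * empLoss ℓ h s)) ∂(P.tilted fun h => -f h)) :=
    fun s => by
      rw [integral_exp_tilted, ← Real.log_inv, inv_div]
      simp only [Pi.add_apply, neg_add]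
  simp only [hpost, herase, hall, hratio]
  exact integral_expLoss_tilted_le hℓ hb (D i) _ (hm i hiT) (hlam (T - 1) (by omega))
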